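/- Let a, b, c, d be purely imaginary quaternions with b ≠ a, c ≠ b, d ≠ c and d ≠ a, and let α, β ∈ ℝ with α ≠ 0 and β ≠ 0. Suppose the quaternionic cross-ratio satisfies q(a,b,c,d) = α/β (a real scalar). Define a* := 0, b* := α (b−a)/‖b−a‖², c* := b* + β (c−b)/‖c−b‖², and d* := β (d−a)/‖d−a‖². Then b* ≠ c*, d* ≠ a*, and q(a*, b*, c*, d*) = α/β. -/

import Mathlib

/-- The quaternionic cross-ratio `q(a,b,c,d) = (a−b)(b−c)⁻¹(c−d)(d−a)⁻¹`. -/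
noncomputable def qcr (a b c d : Quaternion ℝ) : Quaternion ℝ :=
  (a - b) * (b - c)⁻¹ * (c - d) * (d - a)⁻¹

/-- For a purely imaginary quaternion, inversion in the unit sphere is `x ↦ -x⁻¹`. -/
theorem Quaternion.div_norm_sq_smul_eq_neg_smul_inv {x : Quaternion ℝ} (hx : x.re = 0) (r : ℝ) :
    (r / ‖x‖ ^ 2) • x = -(r • x⁻¹) := by
  have hs : star x = -x := Quaternion.star_eq_neg.2 hx
  rw [Quaternion.inv_def, hs, Quaternion.normSq_eq_norm_mul_self, ← sq, smul_neg, smul_neg,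
    neg_neg, smul_smul, div_eq_mul_inv]

/-- If the edges `u`, `v`, `s` of a quadrilateral satisfy the cross-ratio equation with value
`α / β`, so do the edges `α u⁻¹`, `β v⁻¹`, `β s⁻¹`. -/
theorem cross_ratio_inv_edges {k D : Type*} [Field k] [DivisionRing D] [Algebra k D]
    {u v s : D} (hu : u ≠ 0) (hv : v ≠ 0) (hs : s ≠ 0) {α β : k} (hβ : β ≠ 0)
    (h : u * v⁻¹ * (u + v - s) * s⁻¹ = algebraMap k D (α / β)) :
    (α • u⁻¹) * (β • v⁻¹)⁻¹ * (α • u⁻¹ + β • v⁻¹ - β • s⁻¹) * (β • s⁻¹)⁻¹ =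
      algebraMap k D (α / β) := by
  have hclose : u + v - s = (α / β) • (v * u⁻¹ * s) := by
    have h' : u * v⁻¹ * (u + v - s) = (α / β) • s := by
      rw [Algebra.smul_def, ← h, inv_mul_cancel_right₀ hs]
    calc u + v - s = v * u⁻¹ * (u * v⁻¹ * (u + v - s)) := by
          simp only [mul_assoc, inv_mul_cancel_left₀ hu, mul_inv_cancel_left₀ hv]
      _ = _ := by rw [h', mul_smul_comm]
  have hinv (x : D) : (β • x⁻¹)⁻¹ = β⁻¹ • x := by rw [smul_inv₀, inv_inv]
  have hdual : v * (α • u⁻¹ + β • v⁻¹ - β • s⁻¹) * s = β • u := by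
    have e : v * (α • u⁻¹ + β • v⁻¹ - β • s⁻¹) * s = α • (v * u⁻¹ * s) + β • s - β • v := by
      simp only [mul_add, mul_sub, add_mul, sub_mul, mul_smul_comm, smul_mul_assoc,
        mul_inv_cancel₀ hv, one_mul, inv_mul_cancel_right₀ hs]
    have e' : α • (v * u⁻¹ * s) = β • (u + v - s) := by
      rw [hclose, smul_smul, mul_div_cancel₀ _ hβ]
    rw [e, e', smul_sub, smul_add]
    abel
  rw [hinv, hinv]
  calc (α • u⁻¹) * (β⁻¹ • v) * (α • u⁻¹ + β • v⁻¹ - β • s⁻¹) * (β⁻¹ • s)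
      = (α * β⁻¹ * β⁻¹) • (u⁻¹ * (v * (α • u⁻¹ + β • v⁻¹ - β • s⁻¹) * s)) := by
        simp only [smul_mul_assoc, mul_smul_comm, smul_smul, mul_assoc]
        congr 1
        ring
    _ = algebraMap k D (α / β) := by
        rw [hdual, mul_smul_comm, inv_mul_cancel₀ hu, smul_smul, inv_mul_cancel_right₀ hβ,
          Algebra.algebraMap_eq_smul_one, div_eq_mul_inv]

/-- The Christoffel dual quadrilateral `a* = 0`,
`b* = α (b−a)/‖b−a‖²`, `c* = b* + β (c−b)/‖c−b‖²`, `d* = β (d−a)/‖d−a‖²` of an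
elementary quadrilateral with real factorized cross-ratio `α/β` satisfies
`b* ≠ c*`, `d* ≠ a*`, and has the same cross-ratio `α/β`. -/
theorem stmt_11 (a b c d : Quaternion ℝ)
    (ha : a.re = 0) (hb : b.re = 0) (hc : c.re = 0) (hd : d.re = 0)
    (hba : b ≠ a) (hcb : c ≠ b) (hdc : d ≠ c) (hda : d ≠ a)
    (α β : ℝ) (hα : α ≠ 0) (hβ : β ≠ 0)
    (hq : qcr a b c d = ((α / β : ℝ) : Quaternion ℝ))
    (as bs cs ds : Quaternion ℝ)
    (has : as = 0)
    (hbs : bs = (α / ‖b - a‖ ^ 2) • (b - a))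
    (hcs : cs = bs + (β / ‖c - b‖ ^ 2) • (c - b))
    (hds : ds = (β / ‖d - a‖ ^ 2) • (d - a)) :
    bs ≠ cs ∧ ds ≠ as ∧ qcr as bs cs ds = ((α / β : ℝ) : Quaternion ℝ) := by
  have hu : b - a ≠ 0 := sub_ne_zero.2 hba
  have hv : c - b ≠ 0 := sub_ne_zero.2 hcb
  have hs : d - a ≠ 0 := sub_ne_zero.2 hda
  rw [Quaternion.div_norm_sq_smul_eq_neg_smul_inv (by simp [ha, hb])] at hbs
  rw [Quaternion.div_norm_sq_smul_eq_neg_smul_inv (by simp [hb, hc])] at hcs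
  rw [Quaternion.div_norm_sq_smul_eq_neg_smul_inv (by simp [ha, hd])] at hds
  have hbc : bs - cs = β • (c - b)⁻¹ := by rw [hcs]; abel
  refine ⟨?_, ?_, ?_⟩
  · rw [← sub_ne_zero, hbc]
    exact smul_ne_zero hβ (inv_ne_zero hv)
  · rw [hds, has]
    exact neg_ne_zero.2 (smul_ne_zero hβ (inv_ne_zero hs))
  · have hab : as - bs = α • (b - a)⁻¹ := by rw [has, hbs]; abel
    have hcd : cs - ds =
        -(α • (b - a)⁻¹ + β • (c - b)⁻¹ - β • (d - a)⁻¹) := by rw [hcs, hbs, hds]; abel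
    have hda' : ds - as = -(β • (d - a)⁻¹) := by rw [hds, has, sub_zero]
    rw [qcr, hab, hbc, hcd, hda', inv_neg, mul_neg, mul_neg, neg_mul, neg_neg]
    refine cross_ratio_inv_edges hu hv hs hβ (Eq.trans ?_ hq)
    rw [qcr, ← neg_sub b a, ← neg_sub c b, inv_neg, neg_mul_neg]
    congr 2
    abel
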